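/- arXiv:1907.01769 — 5 statements merged into one kernel-verified Lean document; each statement's English description precedes it below -/
import Mathlib

section
/- Let s̄ ∈ {-1,0,1}^p. Then B₁ ∩ {x ∈ ℝ^n : ⟨Ds̄, x⟩ = 1} = ∂B₁ ∩ {x ∈ ℝ^n : sign(D*x) ≼ s̄}. Moreover, if this set is nonempty, then it is an exposed face of B₁. -/
open Matrix Set

noncomputable section

/-- `Vec n` is `ℝ^n`. -/
abbrev Vec (n : ℕ) := Fin n → ℝ

/-- The ℓ¹-norm on `ℝ^p`. -/
def l1 {p : ℕ} (θ : Vec p) : ℝ := ∑ i, |θ i|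

/-- The componentwise sign vector. -/
def sgn {p : ℕ} (θ : Vec p) : Vec p := fun i => Real.sign (θ i)

/-- `s` is a sign vector, i.e. `s ∈ {-1,0,1}^p`. -/
def IsSignVec {p : ℕ} (s : Vec p) : Prop := ∀ i, s i = -1 ∨ s i = 0 ∨ s i = 1

/-- The order `s ≼ s'` on sign vectors: `sᵢ ≠ 0 → s'ᵢ = sᵢ`. -/
def sleq {p : ℕ} (s s' : Vec p) : Prop := ∀ i, s i ≠ 0 → s' i = s i

/-- The cosupport `{i : uᵢ = 0}`. -/
def cosupp {p : ℕ} (u : Vec p) : Set (Fin p) := {i | u i = 0}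

/-- The analysis operator `D* x = Dᵀ x`. -/
def Dstar {n p : ℕ} (D : Matrix (Fin n) (Fin p) ℝ) (x : Vec n) : Vec p := Dᵀ *ᵥ x

/-- The ball `B_r = {x : ‖D*x‖₁ ≤ r}`. -/
def Ball {n p : ℕ} (D : Matrix (Fin n) (Fin p) ℝ) (r : ℝ) : Set (Vec n) :=
  {x | l1 (Dstar D x) ≤ r}

/-- The sphere `∂B_r = {x : ‖D*x‖₁ = r}`. -/
def Sph {n p : ℕ} (D : Matrix (Fin n) (Fin p) ℝ) (r : ℝ) : Set (Vec n) :=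
  {x | l1 (Dstar D x) = r}

/-- `Ker D*_J = {x : (D*x)ᵢ = 0 for all i ∈ J}`. -/
def kerDJ {n p : ℕ} (D : Matrix (Fin n) (Fin p) ℝ) (J : Set (Fin p)) : Set (Vec n) :=
  {x | ∀ i ∈ J, Dstar D x i = 0}

/-- The relative interior of a set. -/
def ri {n : ℕ} (C : Set (Vec n)) : Set (Vec n) := intrinsicInterior ℝ C

/-- The direction of (the affine hull of) a set, as a set of vectors. -/
def dir {n : ℕ} (C : Set (Vec n)) : Set (Vec n) := ((affineSpan ℝ C).direction : Set (Vec n))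

/-- `F` is an exposed face of `X`: the intersection of `X` with a supporting hyperplane. -/
def IsExposedFace {n : ℕ} (X F : Set (Vec n)) : Prop :=
  ∃ (α : Vec n) (β : ℝ), α ≠ 0 ∧ (∀ x ∈ X, α ⬝ᵥ x ≤ β) ∧ F = X ∩ {x | α ⬝ᵥ x = β}

/-- `G` is a face of `X`: a convex extreme subset of `X`. -/
def IsFace {n : ℕ} (X G : Set (Vec n)) : Prop := Convex ℝ G ∧ IsExtreme ℝ X G

/-- `x` is an extreme point of `C`: it is not the midpoint of two distinct points of `C`. -/
def IsExtremePt {n : ℕ} (C : Set (Vec n)) (x : Vec n) : Prop :=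
  x ∈ C ∧ ∀ x₁ ∈ C, ∀ x₂ ∈ C, x = midpoint ℝ x₁ x₂ → x₁ = x₂

/-- The objective `L(x) = (1/2)‖y − Φx‖₂² + λ‖D*x‖₁`. -/
def Lfun {n p q : ℕ} (D : Matrix (Fin n) (Fin p) ℝ) (Phi : Matrix (Fin q) (Fin n) ℝ)
    (y : Vec q) (lam : ℝ) (x : Vec n) : ℝ :=
  (1/2 : ℝ) * ((y - Phi *ᵥ x) ⬝ᵥ (y - Phi *ᵥ x)) + lam * l1 (Dstar D x)

theorem aux_dot {n p : ℕ} (D : Matrix (Fin n) (Fin p) ℝ) (s : Vec p) (x : Vec n) :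
    (D *ᵥ s) ⬝ᵥ x = ∑ i, s i * Dstar D x i := by
  have h : (D *ᵥ s) ⬝ᵥ x = s ⬝ᵥ (Dᵀ *ᵥ x) := by
    rw [dotProduct_comm, dotProduct_mulVec, ← mulVec_transpose, dotProduct_comm]
  rw [h]
  rfl

theorem aux_le {s t : ℝ} (h : s = -1 ∨ s = 0 ∨ s = 1) : s * t ≤ |t| := by
  rcases h with h | h | h <;> subst h
  · simpa using neg_le_abs t
  · simp
  · simpa using le_abs_self t

theorem aux_eq {s t : ℝ} : s * t = |t| ↔ (Real.sign t ≠ 0 → s = Real.sign t) := by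
  rcases lt_trichotomy t 0 with h | h | h
  · rw [Real.sign_of_neg h, abs_of_neg h]
    constructor
    · intro h1 _
      have : (s + 1) * t = 0 := by linarith
      rcases mul_eq_zero.1 this with h2 | h2 <;> linarith
    · intro h1
      rw [h1 (by norm_num)]
      ring
  · subst h
    simp
  · rw [Real.sign_of_pos h, abs_of_pos h]
    constructor
    · intro h1 _
      have : (s - 1) * t = 0 := by linarith
      rcases mul_eq_zero.1 this with h2 | h2 <;> linarith
    · intro h1
      rw [h1 (by norm_num)]
      ring

/-- `B₁ ∩ {x : ⟨Ds̄, x⟩ = 1} = ∂B₁ ∩ {x : sign(D*x) ≼ s̄}`; moreover if this set is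
nonempty then it is an exposed face of `B₁`. -/
theorem stmt_2 {n p : ℕ} (hn : 0 < n) (hp : 0 < p) (D : Matrix (Fin n) (Fin p) ℝ)
    (sb : Vec p) (hsb : IsSignVec sb) :
    Ball D 1 ∩ {x | (D *ᵥ sb) ⬝ᵥ x = 1} = Sph D 1 ∩ {x | sleq (sgn (Dstar D x)) sb} ∧
      ((Ball D 1 ∩ {x | (D *ᵥ sb) ⬝ᵥ x = 1}).Nonempty →
        IsExposedFace (Ball D 1) (Ball D 1 ∩ {x | (D *ᵥ sb) ⬝ᵥ x = 1})) := by
  have hle : ∀ x, (D *ᵥ sb) ⬝ᵥ x ≤ l1 (Dstar D x) := by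
    intro x
    rw [aux_dot]
    exact Finset.sum_le_sum fun i _ => aux_le (hsb i)
  have heq : ∀ x, (D *ᵥ sb) ⬝ᵥ x = l1 (Dstar D x) ↔ sleq (sgn (Dstar D x)) sb := by
    intro x
    rw [aux_dot]
    unfold l1
    rw [Finset.sum_eq_sum_iff_of_le fun i _ => aux_le (hsb i)]
    exact ⟨fun h i => aux_eq.1 (h i (Finset.mem_univ i)), fun h i _ => aux_eq.2 (h i)⟩
  refine ⟨?_, ?_⟩
  · ext x
    simp only [Ball, Sph, mem_inter_iff, mem_setOf_eq, ← heq]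
    have := hle x
    constructor
    · rintro ⟨h1, h2⟩
      constructor <;> linarith
    · rintro ⟨h1, h2⟩
      constructor <;> linarith
  · rintro ⟨x, _, hx⟩
    refine ⟨D *ᵥ sb, 1, ?_, fun y hy => (hle y).trans hy, rfl⟩
    intro h0
    simp [h0] at hx
end
end

section
/- Let C be a nonempty convex subset of ∂B₁. Then the map x ↦ sign(D*x) admits a maximum over C with respect to the order ≼ (i.e. there is s̄ ∈ {-1,0,1}^p with sign(D*x) ≼ s̄ for all x ∈ C and s̄ attained on C), and this maximum is attained at every point of ri(C). In particular, x ↦ sign(D*x) is constant on ri(C). -/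
open Matrix Set

noncomputable section

lemma sgn_aux (u v a b : ℝ) (ha : 0 < a) (hb : 0 < b) (h : |a * u + b * v| = a * |u| + b * |v|)
    (hu : Real.sign u ≠ 0) : Real.sign (a * u + b * v) = Real.sign u := by
  have hu0 : u ≠ 0 := fun h0 => hu (by rw [h0, Real.sign_zero])
  have h1 : 0 ≤ b * (|v| + v) := mul_nonneg hb.le (by linarith [neg_abs_le v])
  have h2 : 0 ≤ b * (|v| - v) := mul_nonneg hb.le (by linarith [le_abs_self v])
  rcases lt_or_gt_of_ne hu0 with hlt | hgt
  · have h3 : 0 < a * (-u) := mul_pos ha (by linarith)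
    have : a * u + b * v < 0 := by
      by_contra hc
      rw [abs_of_nonneg (not_lt.1 hc), abs_of_neg hlt] at h
      linarith
    rw [Real.sign_of_neg this, Real.sign_of_neg hlt]
  · have h3 : 0 < a * u := mul_pos ha hgt
    have : 0 < a * u + b * v := by
      by_contra hc
      rw [abs_of_nonpos (not_lt.1 hc), abs_of_pos hgt] at h
      linarith
    rw [Real.sign_of_pos this, Real.sign_of_pos hgt]

lemma sleq_comb {n p : ℕ} (D : Matrix (Fin n) (Fin p) ℝ)
    (C : Set (Vec n)) (hCc : Convex ℝ C) (hCsub : C ⊆ Sph D 1) (x y : Vec n) (hx : x ∈ C)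
    (hy : y ∈ C) (a b : ℝ) (ha : 0 < a) (hb : 0 < b) (hab : a + b = 1) :
    sleq (sgn (Dstar D x)) (sgn (Dstar D (a • x + b • y))) := by
  have hz := hCsub (hCc hx hy ha.le hb.le hab)
  have hx' := hCsub hx
  have hy' := hCsub hy
  simp only [Sph, l1, Set.mem_ofPred_eq] at hz hx' hy'
  have hD : ∀ i, Dstar D (a • x + b • y) i = a * Dstar D x i + b * Dstar D y i := by
    intro i
    simp [Dstar, Matrix.mulVec_add, Matrix.mulVec_smul]
  simp only [hD] at hz
  have hle : ∀ i ∈ Finset.univ, |a * Dstar D x i + b * Dstar D y i|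
      ≤ a * |Dstar D x i| + b * |Dstar D y i| := by
    intro i _
    refine (abs_add_le _ _).trans ?_
    rw [abs_mul, abs_mul, abs_of_pos ha, abs_of_pos hb]
  have hs : ∑ i, |a * Dstar D x i + b * Dstar D y i|
      = ∑ i, (a * |Dstar D x i| + b * |Dstar D y i|) := by
    rw [Finset.sum_add_distrib, ← Finset.mul_sum, ← Finset.mul_sum, hz, hx', hy']
    linarith
  have heq := (Finset.sum_eq_sum_iff_of_le hle).1 hs
  intro i hi
  simp only [sgn] at hi ⊢
  rw [hD]
  exact sgn_aux _ _ a b ha hb (heq i (Finset.mem_univ i)) hi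

lemma ri_ext {n : ℕ} (C : Set (Vec n)) (x y : Vec n) (hx : x ∈ ri C) (hy : y ∈ C) :
    ∃ z ∈ C, ∃ a b : ℝ, 0 < a ∧ 0 < b ∧ a + b = 1 ∧ x = a • y + b • z := by
  obtain ⟨x', hx', rfl⟩ := mem_intrinsicInterior.1 hx
  have hya : y ∈ affineSpan ℝ C := subset_affineSpan ℝ C hy
  let f : ℝ → affineSpan ℝ C := fun r =>
    ⟨AffineMap.lineMap y (x' : Vec n) r, AffineMap.lineMap_mem r hya x'.2⟩
  have hf : Continuous f := by
    refine Continuous.subtype_mk ?_ _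
    exact AffineMap.lineMap_continuous
  have hf1 : f 1 = x' := by
    apply Subtype.ext
    simp [f]
  have hev : ∀ᶠ r in nhds (1 : ℝ), f r ∈ interior ((↑) ⁻¹' C : Set (affineSpan ℝ C)) := by
    apply hf.continuousAt.eventually_mem
    rw [hf1]
    exact isOpen_interior.mem_nhds hx'
  have hev' := hev.filter_mono (nhdsWithin_le_nhds (s := Set.Ioi (1 : ℝ)))
  obtain ⟨r, hr, hr1⟩ := (hev'.and self_mem_nhdsWithin).exists
  have hr1 : 1 < r := hr1
  have hr0 : 0 < r := by linarith
  have hrC : f r ∈ ((↑) ⁻¹' C : Set (affineSpan ℝ C)) := interior_subset hr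
  refine ⟨f r, hrC, 1 - r⁻¹, r⁻¹, ?_, by positivity, by ring, ?_⟩
  · have := inv_lt_one_of_one_lt₀ hr1
    linarith
  · ext i
    simp [f, AffineMap.lineMap_apply]
    field_simp
    ring

/-- on a nonempty convex `C ⊆ ∂B₁`, the map `x ↦ sign(D*x)` admits a maximum `s̄`
w.r.t. `≼`, attained at every point of `ri(C)`; in particular it is constant on `ri(C)`. -/
theorem stmt_6 {n p : ℕ} (hn : 0 < n) (hp : 0 < p) (D : Matrix (Fin n) (Fin p) ℝ)
    (C : Set (Vec n)) (hCne : C.Nonempty) (hCc : Convex ℝ C) (hCsub : C ⊆ Sph D 1) :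
    ∃ sb : Vec p, IsSignVec sb ∧
      (∀ x ∈ C, sleq (sgn (Dstar D x)) sb) ∧
      (∃ x ∈ C, sgn (Dstar D x) = sb) ∧
      (∀ x ∈ ri C, sgn (Dstar D x) = sb) := by
  obtain ⟨x0, hx0⟩ := Set.Nonempty.intrinsicInterior hCc hCne
  have key : ∀ x ∈ ri C, ∀ y ∈ C, sleq (sgn (Dstar D y)) (sgn (Dstar D x)) := by
    intro x hx y hy
    obtain ⟨z, hz, a, b, ha, hb, hab, rfl⟩ := ri_ext C x y hx hy
    exact sleq_comb D C hCc hCsub y z hy hz a b ha hb hab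
  refine ⟨sgn (Dstar D x0), ?_, key x0 hx0, ⟨x0, intrinsicInterior_subset hx0, rfl⟩, ?_⟩
  · intro i
    rcases Real.sign_apply_eq (Dstar D x0 i) with h | h | h <;> simp [sgn, h]
  · intro x hx
    have h1 := key x hx x0 (intrinsicInterior_subset hx0)
    have h2 := key x0 hx0 x (intrinsicInterior_subset hx)
    funext i
    by_cases h : sgn (Dstar D x) i = 0
    · by_cases h' : sgn (Dstar D x0) i = 0
      · rw [h, h']
      · exact h1 i h'
    · exact (h2 i h).symm
end
end

section
/- Let A be an affine subspace of ℝ^n with ∅ ≠ A ∩ B₁ ⊆ ∂B₁. Let x̄ ∈ ri(A ∩ B₁), s̄ = sign(D*x̄), and F̄ = B₁ ∩ {x ∈ ℝ^n : ⟨Ds̄, x⟩ = 1}. Then A ∩ B₁ = A ∩ F̄. -/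
open Matrix Set

noncomputable section

theorem aux_ext {n : ℕ} (C : Set (Vec n)) (xb x : Vec n) (hxb : xb ∈ intrinsicInterior ℝ C)
    (hx : x ∈ C) : ∃ t : ℝ, 0 < t ∧ xb + t • (xb - x) ∈ C := by
  rw [mem_intrinsicInterior] at hxb
  obtain ⟨y, hy, rfl⟩ := hxb
  have hxs : x ∈ affineSpan ℝ C := subset_affineSpan ℝ C hx
  have hmem : ∀ t : ℝ, (y : Vec n) + t • ((y : Vec n) - x) ∈ affineSpan ℝ C := by
    intro t
    have h := AffineSubspace.vadd_mem_of_mem_direction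
      (Submodule.smul_mem _ t (AffineSubspace.vsub_mem_direction y.2 hxs)) y.2
    simpa [add_comm] using h
  let g : ℝ → affineSpan ℝ C := fun t => ⟨(y : Vec n) + t • ((y : Vec n) - x), hmem t⟩
  have hg : Continuous g := by
    apply Continuous.subtype_mk
    fun_prop
  have hg0 : g 0 = y := by
    apply Subtype.ext
    simp [g]
  have hev : ∀ᶠ t in nhds (0 : ℝ), g t ∈ ((↑) ⁻¹' C : Set (affineSpan ℝ C)) := by
    have h1 : ((↑) ⁻¹' C : Set (affineSpan ℝ C)) ∈ nhds (g 0) := by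
      rw [hg0]
      exact mem_interior_iff_mem_nhds.mp hy
    exact hg.continuousAt h1
  obtain ⟨e, he, h⟩ := Metric.eventually_nhds_iff.mp hev
  refine ⟨e / 2, by positivity, ?_⟩
  have := @h (e / 2) (by rw [Real.dist_eq, sub_zero, abs_of_pos (by positivity)]; linarith)
  exact this

theorem aux_le_s9 {p : ℕ} (v u : Vec p) : sgn v ⬝ᵥ u ≤ l1 u := by
  unfold dotProduct l1
  apply Finset.sum_le_sum
  intro i _
  unfold sgn
  rcases Real.sign_apply_eq (v i) with h | h | h <;> rw [h]
  · simpa using neg_le_abs (u i)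
  · simp
  · simpa using le_abs_self (u i)

theorem aux_eq_s9 {p : ℕ} (v : Vec p) : sgn v ⬝ᵥ v = l1 v := by
  unfold dotProduct l1
  apply Finset.sum_congr rfl
  intro i _
  unfold sgn
  rcases lt_trichotomy (v i) 0 with h | h | h
  · rw [Real.sign_of_neg h, abs_of_neg h]; ring
  · rw [h]; simp
  · rw [Real.sign_of_pos h, abs_of_pos h]; ring

theorem aux_adj {n p : ℕ} (D : Matrix (Fin n) (Fin p) ℝ) (s : Vec p) (x : Vec n) :
    (D *ᵥ s) ⬝ᵥ x = s ⬝ᵥ Dstar D x := by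
  unfold Dstar
  rw [Matrix.mulVec_transpose, dotProduct_comm, Matrix.dotProduct_mulVec, dotProduct_comm]

/-- if `∅ ≠ A ∩ B₁ ⊆ ∂B₁`, `x̄ ∈ ri(A ∩ B₁)`, `s̄ = sign(D*x̄)`, and
`F̄ = B₁ ∩ {x : ⟨Ds̄, x⟩ = 1}`, then `A ∩ B₁ = A ∩ F̄`. -/
theorem stmt_9 {n p : ℕ} (hn : 0 < n) (hp : 0 < p) (D : Matrix (Fin n) (Fin p) ℝ)
    (A : AffineSubspace ℝ (Vec n))
    (hne : ((A : Set (Vec n)) ∩ Ball D 1).Nonempty)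
    (hsub : (A : Set (Vec n)) ∩ Ball D 1 ⊆ Sph D 1)
    (xb : Vec n) (hxb : xb ∈ ri ((A : Set (Vec n)) ∩ Ball D 1))
    (sb : Vec p) (hsb : sb = sgn (Dstar D xb))
    (Fb : Set (Vec n)) (hFb : Fb = Ball D 1 ∩ {x | (D *ᵥ sb) ⬝ᵥ x = 1}) :
    (A : Set (Vec n)) ∩ Ball D 1 = (A : Set (Vec n)) ∩ Fb := by
  subst hFb
  ext x
  constructor
  · rintro ⟨hA, hB⟩
    refine ⟨hA, hB, ?_⟩
    obtain ⟨t, ht, hy⟩ := aux_ext _ xb x hxb ⟨hA, hB⟩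
    have hb : l1 (Dstar D xb) = 1 := hsub (intrinsicInterior_subset hxb)
    have hx1 : l1 (Dstar D x) ≤ 1 := hB
    have hy1 : l1 (Dstar D (xb + t • (xb - x))) ≤ 1 := hy.2
    have e1 : (D *ᵥ sb) ⬝ᵥ xb = 1 := by rw [aux_adj, hsb, aux_eq_s9, hb]
    have e2 : (D *ᵥ sb) ⬝ᵥ x ≤ 1 := by
      rw [aux_adj, hsb]; exact (aux_le_s9 _ _).trans hx1
    have e3 : (D *ᵥ sb) ⬝ᵥ (xb + t • (xb - x)) ≤ 1 := by
      rw [aux_adj, hsb]; exact (aux_le_s9 _ _).trans hy1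
    rw [dotProduct_add, dotProduct_smul, dotProduct_sub, e1, smul_eq_mul] at e3
    show (D *ᵥ sb) ⬝ᵥ x = 1
    nlinarith
  · rintro ⟨hA, hB, _⟩
    exact ⟨hA, hB⟩
end
end

section
/- Let F₁ and F₂ be nonempty exposed faces of B₁, and for i = 1, 2 let sᵢ = sign(D*xᵢ) for some xᵢ ∈ ri(Fᵢ). Then F₁ ⊆ F₂ if and only if s₁ ≼ s₂. In this case, with J₁ = cosupp(s₁): F₁ = F₂ ∩ {x ∈ ℝ^n : J₁ ⊆ cosupp(D*x)}, ri(F₁) = F₂ ∩ {x ∈ ℝ^n : J₁ = cosupp(D*x)}, and dir(F₁) = dir(F₂) ∩ Ker D*_{J₁}. -/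
open Matrix Set

noncomputable section

lemma Dstar_add {n p : ℕ} (D : Matrix (Fin n) (Fin p) ℝ) (x y : Vec n) (i : Fin p) :
    Dstar D (x + y) i = Dstar D x i + Dstar D y i := by
  simp [Dstar, Matrix.mulVec_add]

lemma Dstar_sub {n p : ℕ} (D : Matrix (Fin n) (Fin p) ℝ) (x y : Vec n) (i : Fin p) :
    Dstar D (x - y) i = Dstar D x i - Dstar D y i := by
  simp [Dstar, Matrix.mulVec_sub]

lemma Dstar_smul {n p : ℕ} (D : Matrix (Fin n) (Fin p) ℝ) (c : ℝ) (x : Vec n) (i : Fin p) :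
    Dstar D (c • x) i = c * Dstar D x i := by
  simp [Dstar, Matrix.mulVec_smul]

lemma Dstar_cont {n p : ℕ} (D : Matrix (Fin n) (Fin p) ℝ) (i : Fin p) :
    Continuous (fun x => Dstar D x i) := by
  unfold Dstar
  fun_prop

lemma sign_mul_self_eq (r : ℝ) : Real.sign r * r = |r| := by
  rcases lt_trichotomy r 0 with h | h | h
  · rw [Real.sign_of_neg h, abs_of_neg h]; ring
  · simp [h]
  · rw [Real.sign_of_pos h, abs_of_pos h]; ring

lemma sgn_isSign {p : ℕ} (θ : Vec p) : IsSignVec (sgn θ) := fun i => Real.sign_apply_eq (θ i)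

/-- affine hull candidate -/
def Aff {n p : ℕ} (D : Matrix (Fin n) (Fin p) ℝ) (s : Vec p) : AffineSubspace ℝ (Vec n) where
  carrier := {y | (∀ i, s i = 0 → Dstar D y i = 0) ∧ ∑ i, s i * Dstar D y i = 1}
  smul_vsub_vadd_mem' := by
    rintro c a b d ⟨ha, ha'⟩ ⟨hb, hb'⟩ ⟨hd, hd'⟩
    refine ⟨fun i hi => ?_, ?_⟩
    · simp [Dstar_add, Dstar_sub, Dstar_smul, ha i hi, hb i hi, hd i hi]
    · simp only [vsub_eq_sub, vadd_eq_add, Dstar_add, Dstar_sub, Dstar_smul]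
      calc _ = c * (∑ i, s i * Dstar D a i - ∑ i, s i * Dstar D b i)
            + ∑ i, s i * Dstar D d i := by
            rw [← Finset.sum_sub_distrib, Finset.mul_sum, ← Finset.sum_add_distrib]
            exact Finset.sum_congr rfl fun i _ => by ring
        _ = 1 := by rw [ha', hb', hd']; ring

/-- direction candidate -/
def DirS {n p : ℕ} (D : Matrix (Fin n) (Fin p) ℝ) (s : Vec p) : Submodule ℝ (Vec n) where
  carrier := {y | (∀ i, s i = 0 → Dstar D y i = 0) ∧ ∑ i, s i * Dstar D y i = 0}
  zero_mem' := by simp [Dstar]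
  add_mem' := by
    rintro a b ⟨ha, ha'⟩ ⟨hb, hb'⟩
    refine ⟨fun i hi => ?_, ?_⟩
    · simp [Dstar_add, ha i hi, hb i hi]
    · simp only [Dstar_add, mul_add, Finset.sum_add_distrib, ha', hb', add_zero]
  smul_mem' := by
    rintro c a ⟨ha, ha'⟩
    refine ⟨fun i hi => ?_, ?_⟩
    · simp [Dstar_smul, ha i hi]
    · simp only [Dstar_smul, mul_left_comm _ c, ← Finset.mul_sum, ha', mul_zero]

def GG {n p : ℕ} (D : Matrix (Fin n) (Fin p) ℝ) (s : Vec p) : Set (Vec n) :=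
  {x | l1 (Dstar D x) = 1 ∧ sleq (sgn (Dstar D x)) s}

def UU {n p : ℕ} (D : Matrix (Fin n) (Fin p) ℝ) (s : Vec p) : Set (Vec n) :=
  {x | ∀ i, s i ≠ 0 → 0 < s i * Dstar D x i}

lemma UU_open {n p : ℕ} (D : Matrix (Fin n) (Fin p) ℝ) (s : Vec p) : IsOpen (UU D s) := by
  have : UU D s = ⋂ i, {x | s i ≠ 0 → 0 < s i * Dstar D x i} := by ext; simp [UU]
  rw [this]
  refine isOpen_iInter_of_finite fun i => ?_
  by_cases h : s i = 0
  · simp [h]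
  · simp only [ne_eq, h, not_false_eq_true, forall_const]
    exact isOpen_lt continuous_const (continuous_const.mul (Dstar_cont D i))

lemma sgn_eq_zero {p : ℕ} (θ : Vec p) (i : Fin p) : sgn θ i = 0 ↔ θ i = 0 := Real.sign_eq_zero_iff

lemma GG_sub_Aff {n p : ℕ} {D : Matrix (Fin n) (Fin p) ℝ} {s : Vec p} {x : Vec n}
    (hx : x ∈ GG D s) : x ∈ Aff D s := by
  obtain ⟨h1, h2⟩ := hx
  refine ⟨fun i hi => ?_, ?_⟩
  · by_contra h
    have h' : sgn (Dstar D x) i ≠ 0 := fun h0 => h ((sgn_eq_zero _ _).1 h0)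
    exact h' ((h2 i h').symm.trans hi)
  · rw [← h1, l1]
    refine Finset.sum_congr rfl fun i _ => ?_
    by_cases h : sgn (Dstar D x) i = 0
    · simp [(sgn_eq_zero _ _).1 h]
    · rw [h2 i h]; exact sign_mul_self_eq _

lemma UA {n p : ℕ} {D : Matrix (Fin n) (Fin p) ℝ} {s : Vec p} (hs : IsSignVec s) {x : Vec n}
    (hU : x ∈ UU D s) (hA : x ∈ Aff D s) : l1 (Dstar D x) = 1 ∧ sgn (Dstar D x) = s := by
  obtain ⟨h1, h2⟩ := hA
  have hsg : sgn (Dstar D x) = s := by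
    ext i
    rcases hs i with h | h | h
    · have := hU i (by rw [h]; norm_num)
      rw [h] at this ⊢
      exact Real.sign_of_neg (by linarith)
    · rw [h, sgn_eq_zero]; exact h1 i h
    · have := hU i (by rw [h]; norm_num)
      rw [h] at this ⊢
      exact Real.sign_of_pos (by linarith)
  refine ⟨?_, hsg⟩
  rw [← h2, l1]
  refine Finset.sum_congr rfl fun i _ => ?_
  rw [← hsg]; exact (sign_mul_self_eq _).symm

lemma mem_UU {n p : ℕ} (D : Matrix (Fin n) (Fin p) ℝ) (x : Vec n) :
    x ∈ UU D (sgn (Dstar D x)) := by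
  intro i hi
  have h : Dstar D x i ≠ 0 := fun h0 => hi ((sgn_eq_zero _ _).2 h0)
  have := sign_mul_self_eq (Dstar D x i)
  show 0 < Real.sign (Dstar D x i) * Dstar D x i
  rw [this]; exact abs_pos.2 h

lemma self_GG {n p : ℕ} {D : Matrix (Fin n) (Fin p) ℝ} {x : Vec n} (h : l1 (Dstar D x) = 1) :
    x ∈ GG D (sgn (Dstar D x)) := ⟨h, fun _ _ => rfl⟩

lemma sleq_refl' {p : ℕ} (s : Vec p) : sleq s s := fun _ _ => rfl

lemma UA_GG {n p : ℕ} {D : Matrix (Fin n) (Fin p) ℝ} {s : Vec p} (hs : IsSignVec s) {x : Vec n}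
    (hU : x ∈ UU D s) (hA : x ∈ Aff D s) : x ∈ GG D s := by
  obtain ⟨h1, h2⟩ := UA hs hU hA
  exact ⟨h1, h2 ▸ sleq_refl' _⟩

/-- move a little along `v` -/
lemma eps_exists {n : ℕ} {U : Set (Vec n)} (hU : IsOpen U) {x : Vec n} (hx : x ∈ U) (v : Vec n) :
    ∃ ε : ℝ, 0 < ε ∧ x + ε • v ∈ U := by
  have hc : Continuous (fun t : ℝ => x + t • v) := by fun_prop
  have h0 : (fun t : ℝ => x + t • v) ⁻¹' U ∈ nhds (0 : ℝ) :=
    (hU.preimage hc).mem_nhds (by simpa using hx)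
  obtain ⟨δ, hδ, hb⟩ := Metric.mem_nhds_iff.1 h0
  refine ⟨δ / 2, by positivity, hb ?_⟩
  rw [Metric.mem_ball, Real.dist_eq, sub_zero, abs_of_pos (by positivity)]
  linarith

lemma ri_ext_s13 {n : ℕ} {F : Set (Vec n)} {x₀ x : Vec n} (h₀ : x₀ ∈ ri F) (hx : x ∈ F) :
    ∃ ε : ℝ, 0 < ε ∧ x₀ + ε • (x₀ - x) ∈ F := by
  obtain ⟨y, hy, rfl⟩ := mem_intrinsicInterior.1 h₀
  rw [mem_interior] at hy
  obtain ⟨t, ht, hto, hyt⟩ := hy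
  obtain ⟨U, hU, rfl⟩ := isOpen_induced_iff.1 hto
  obtain ⟨ε, hε, hm⟩ := eps_exists hU hyt ((y : Vec n) - x)
  refine ⟨ε, hε, ?_⟩
  have hspan : (y : Vec n) + ε • ((y : Vec n) - x) ∈ affineSpan ℝ F := by
    have := (affineSpan ℝ F).smul_vsub_vadd_mem ε y.2 (subset_affineSpan ℝ F hx) y.2
    simpa [add_comm] using this
  exact ht (show (⟨_, hspan⟩ : affineSpan ℝ F) ∈ _ from hm)

lemma l1_smul {n p : ℕ} (D : Matrix (Fin n) (Fin p) ℝ) (c : ℝ) (hc : 0 ≤ c) (x : Vec n) :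
    l1 (Dstar D (c • x)) = c * l1 (Dstar D x) := by
  simp only [l1, Dstar_smul, abs_mul, abs_of_nonneg hc, Finset.mul_sum]

lemma l1_cont {n p : ℕ} (D : Matrix (Fin n) (Fin p) ℝ) : Continuous (fun x => l1 (Dstar D x)) := by
  unfold l1
  exact continuous_finsetSum _ fun i _ => (Dstar_cont D i).abs

lemma face_sphere {n p : ℕ} {D : Matrix (Fin n) (Fin p) ℝ} {F : Set (Vec n)}
    (hF : IsExposedFace (Ball D 1) F) {x : Vec n} (hx : x ∈ F) : l1 (Dstar D x) = 1 := by
  obtain ⟨α, β, hα, hB, rfl⟩ := hF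
  obtain ⟨hx1, hx2⟩ := hx
  have hopen : IsOpen {x | l1 (Dstar D x) < 1} := isOpen_lt (l1_cont D) continuous_const
  have haa : 0 < α ⬝ᵥ α := by
    have h0 : 0 ≤ α ⬝ᵥ α := Finset.sum_nonneg fun i _ => mul_self_nonneg _
    exact lt_of_le_of_ne h0 fun h => hα (dotProduct_self_eq_zero.1 h.symm)
  by_contra hne
  have hlt : l1 (Dstar D x) < 1 := lt_of_le_of_ne hx1 hne
  obtain ⟨ε, hε, hm⟩ := eps_exists hopen hlt α
  have := hB (x + ε • α) (le_of_lt hm : l1 (Dstar D (x + ε • α)) ≤ 1)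
  have hx2' : α ⬝ᵥ x = β := hx2
  rw [dotProduct_add, dotProduct_smul, hx2', smul_eq_mul] at this
  nlinarith [mul_pos hε haa]

lemma face_eq {n p : ℕ} {D : Matrix (Fin n) (Fin p) ℝ} {F : Set (Vec n)}
    (hF : IsExposedFace (Ball D 1) F) {x₀ : Vec n} (hx₀ : x₀ ∈ ri F) :
    F = GG D (sgn (Dstar D x₀)) := by
  have hx₀F : x₀ ∈ F := intrinsicInterior_subset hx₀
  have h10 := face_sphere hF hx₀F
  ext x
  constructor
  · intro hx
    have h1 := face_sphere hF hx
    refine ⟨h1, ?_⟩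
    obtain ⟨ε, hε, hy⟩ := ri_ext_s13 hx₀ hx
    have hy1 := face_sphere hF hy
    set y := x₀ + ε • (x₀ - x) with hyd
    have hyi : ∀ i, Dstar D y i = Dstar D x₀ i + ε * (Dstar D x₀ i - Dstar D x i) := by
      intro i; rw [hyd, Dstar_add, Dstar_smul, Dstar_sub]
    have hle : ∀ i ∈ Finset.univ, (1 + ε) * |Dstar D x₀ i| ≤ |Dstar D y i| + ε * |Dstar D x i| := by
      intro i _
      have h : (1 + ε) * Dstar D x₀ i = Dstar D y i + ε * Dstar D x i := by rw [hyi]; ring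
      calc (1 + ε) * |Dstar D x₀ i| = |(1 + ε) * Dstar D x₀ i| := by
            rw [abs_mul, abs_of_pos (by linarith : 0 < 1 + ε)]
        _ ≤ |Dstar D y i| + |ε * Dstar D x i| := by rw [h]; exact abs_add_le _ _
        _ = _ := by rw [abs_mul, abs_of_pos hε]
    have hsum : ∑ i, (1 + ε) * |Dstar D x₀ i| = ∑ i, (|Dstar D y i| + ε * |Dstar D x i|) := by
      rw [Finset.sum_add_distrib, ← Finset.mul_sum, ← Finset.mul_sum]
      unfold l1 at h1 h10 hy1
      rw [h1, h10, hy1]; ring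
    have heq := (Finset.sum_eq_sum_iff_of_le hle).1 hsum
    intro i hi
    have hxi : Dstar D x i ≠ 0 := fun h0 => hi ((sgn_eq_zero _ _).2 h0)
    have he := heq i (Finset.mem_univ i)
    rw [hyi i] at he
    have key : 0 < Dstar D x₀ i * Dstar D x i := by
      generalize Dstar D x i = a at *
      generalize Dstar D x₀ i = b at *
      rcases lt_or_gt_of_ne hxi with ha | ha
      · by_contra hcon
        have hb : 0 ≤ b := by by_contra hb; push Not at hb; exact hcon (mul_pos_of_neg_of_neg hb ha)
        rw [abs_of_nonneg hb, abs_of_neg ha, abs_of_pos (by nlinarith)] at he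
        nlinarith
      · by_contra hcon
        have hb : b ≤ 0 := by by_contra hb; push Not at hb; exact hcon (mul_pos hb ha)
        rw [abs_of_nonpos hb, abs_of_pos ha, abs_of_neg (by nlinarith)] at he
        nlinarith
    show Real.sign _ = Real.sign _
    rcases lt_or_gt_of_ne hxi with ha | ha
    · rw [Real.sign_of_neg ha, Real.sign_of_neg (by nlinarith)]
    · rw [Real.sign_of_pos ha, Real.sign_of_pos (by nlinarith)]
  · intro hx
    obtain ⟨ε, hε, hm⟩ := eps_exists (UU_open D _) (mem_UU D x₀) (x₀ - x)
    have hA0 := GG_sub_Aff (self_GG h10)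
    have hA : x₀ + ε • (x₀ - x) ∈ Aff D (sgn (Dstar D x₀)) := by
      have := (Aff D _).smul_vsub_vadd_mem ε hA0 (GG_sub_Aff hx) hA0
      simpa [add_comm] using this
    have hy := (UA (sgn_isSign _) hm hA).1
    obtain ⟨α, β, hα, hB, rfl⟩ := hF
    have h1 := hB _ (show _ ∈ Ball D 1 from hy.le)
    have h2 := hB x (show _ ∈ Ball D 1 from hx.1.le)
    have h3 : α ⬝ᵥ x₀ = β := hx₀F.2
    refine ⟨hx.1.le, le_antisymm h2 ?_⟩
    rw [dotProduct_add, dotProduct_smul, dotProduct_sub, h3, smul_eq_mul] at h1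
    by_contra hcon
    push Not at hcon
    nlinarith [mul_pos hε (sub_pos.2 hcon)]

lemma ri_GG {n p : ℕ} {D : Matrix (Fin n) (Fin p) ℝ} {x : Vec n} (h1 : l1 (Dstar D x) = 1) :
    x ∈ ri (GG D (sgn (Dstar D x))) := by
  refine mem_intrinsicInterior.2 ⟨⟨x, subset_affineSpan ℝ _ (self_GG h1)⟩, ?_, rfl⟩
  refine mem_interior.2 ⟨Subtype.val ⁻¹' UU D (sgn (Dstar D x)), ?_,
    (UU_open D _).preimage continuous_subtype_val, mem_UU D x⟩
  rintro ⟨y, hy⟩ hyU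
  have hle : affineSpan ℝ (GG D (sgn (Dstar D x))) ≤ Aff D (sgn (Dstar D x)) :=
    affineSpan_le.2 fun z hz => GG_sub_Aff hz
  exact UA_GG (sgn_isSign _) hyU (hle hy)

lemma dir_GG {n p : ℕ} {D : Matrix (Fin n) (Fin p) ℝ} {x : Vec n} (h1 : l1 (Dstar D x) = 1) :
    dir (GG D (sgn (Dstar D x))) = DirS D (sgn (Dstar D x)) := by
  have hA0 := GG_sub_Aff (self_GG h1)
  unfold dir
  rw [direction_affineSpan]
  congr 1
  apply le_antisymm
  · refine Submodule.span_le.2 ?_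
    rintro _ ⟨a, ha, b, hb, rfl⟩
    obtain ⟨ha1, ha2⟩ := GG_sub_Aff ha
    obtain ⟨hb1, hb2⟩ := GG_sub_Aff hb
    refine ⟨fun i hi => ?_, ?_⟩
    · simp [Dstar_sub, ha1 i hi, hb1 i hi]
    · simp only [vsub_eq_sub, Dstar_sub, mul_sub, Finset.sum_sub_distrib, ha2, hb2, sub_self]
  · rintro v ⟨hv1, hv2⟩
    obtain ⟨ε, hε, hm⟩ := eps_exists (UU_open D _) (mem_UU D x) v
    have hA : x + ε • v ∈ Aff D (sgn (Dstar D x)) := by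
      refine ⟨fun i hi => ?_, ?_⟩
      · simp [Dstar_add, Dstar_smul, hv1 i hi, hA0.1 i hi]
      · simp only [Dstar_add, Dstar_smul, mul_add, Finset.sum_add_distrib, mul_left_comm _ ε,
          ← Finset.mul_sum, hv2, hA0.2]
        ring
    have := vsub_mem_vectorSpan ℝ (UA_GG (sgn_isSign _) hm hA) (self_GG h1)
    have h2 := Submodule.smul_mem _ ε⁻¹ this
    simpa [smul_smul, inv_mul_cancel₀ hε.ne'] using h2

lemma sleq_antisymm' {p : ℕ} {s t : Vec p} (h : sleq s t) (h' : sleq t s) : s = t := by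
  ext i
  by_cases hs : s i = 0
  · by_cases ht : t i = 0
    · rw [hs, ht]
    · exact h' i ht
  · exact (h i hs).symm

/-- for nonempty exposed faces `F₁, F₂` of `B₁` with signs `sᵢ = sign(D*xᵢ)`,
`xᵢ ∈ ri(Fᵢ)`: `F₁ ⊆ F₂ ↔ s₁ ≼ s₂`, and in this case explicit descriptions of `F₁`, `ri(F₁)`, and
`dir(F₁)` in terms of `F₂` and `J₁ = cosupp(s₁)`. -/
theorem stmt_13 {n p : ℕ} (hn : 0 < n) (hp : 0 < p) (D : Matrix (Fin n) (Fin p) ℝ)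
    (F₁ F₂ : Set (Vec n))
    (hF₁ : IsExposedFace (Ball D 1) F₁) (hne₁ : F₁.Nonempty)
    (hF₂ : IsExposedFace (Ball D 1) F₂) (hne₂ : F₂.Nonempty)
    (x₁ : Vec n) (hx₁ : x₁ ∈ ri F₁) (x₂ : Vec n) (hx₂ : x₂ ∈ ri F₂)
    (s₁ : Vec p) (hs₁ : s₁ = sgn (Dstar D x₁))
    (s₂ : Vec p) (hs₂ : s₂ = sgn (Dstar D x₂)) :
    (F₁ ⊆ F₂ ↔ sleq s₁ s₂) ∧
    (F₁ ⊆ F₂ →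
      F₁ = F₂ ∩ {x : Vec n | cosupp s₁ ⊆ cosupp (Dstar D x)} ∧
      ri F₁ = F₂ ∩ {x : Vec n | cosupp s₁ = cosupp (Dstar D x)} ∧
      dir F₁ = dir F₂ ∩ kerDJ D (cosupp s₁)) := by
  have e₁ := face_eq hF₁ hx₁
  have e₂ := face_eq hF₂ hx₂
  have n₁ := face_sphere hF₁ (intrinsicInterior_subset hx₁)
  have n₂ := face_sphere hF₂ (intrinsicInterior_subset hx₂)
  have d₁ := dir_GG n₁
  have d₂ := dir_GG n₂
  rw [← hs₁] at e₁ d₁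
  rw [← hs₂] at e₂ d₂
  have hiff : F₁ ⊆ F₂ ↔ sleq s₁ s₂ := by
    constructor
    · intro h
      have := h (intrinsicInterior_subset hx₁)
      rw [e₂] at this
      rw [hs₁]; exact this.2
    · intro h x hx
      rw [e₁] at hx
      rw [e₂]
      refine ⟨hx.1, fun i hi => ?_⟩
      have h1 := hx.2 i hi
      rw [← h1]; exact h i (by rw [h1]; exact hi)
  refine ⟨hiff, fun hsub => ?_⟩
  have hle := hiff.1 hsub
  have hF : F₁ = F₂ ∩ {x : Vec n | cosupp s₁ ⊆ cosupp (Dstar D x)} := by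
    ext x
    constructor
    · intro hx
      refine ⟨hsub hx, fun i hi => ?_⟩
      rw [e₁] at hx
      exact (GG_sub_Aff hx).1 i hi
    · rintro ⟨hx, hc⟩
      rw [e₂] at hx
      rw [e₁]
      refine ⟨hx.1, fun i hi => ?_⟩
      have h1 : s₁ i ≠ 0 := fun h0 => hi ((sgn_eq_zero _ _).2 (hc h0))
      rw [← hx.2 i hi, hle i h1]
  refine ⟨hF, ?_, ?_⟩
  · ext x
    constructor
    · intro hx
      have hxF : x ∈ F₁ := intrinsicInterior_subset hx
      have e := face_eq hF₁ hx
      refine ⟨hsub hxF, ?_⟩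
      have a1 : sleq (sgn (Dstar D x)) s₁ := by rw [e₁] at hxF; exact hxF.2
      have a2 : sleq s₁ (sgn (Dstar D x)) := by
        have := intrinsicInterior_subset hx₁
        rw [e] at this
        rw [hs₁]; exact this.2
      have := sleq_antisymm' a1 a2
      rw [← this]
      ext i
      exact sgn_eq_zero _ _
    · rintro ⟨hx, hc⟩
      have hc' : cosupp s₁ = cosupp (Dstar D x) := hc
      have hxF : x ∈ F₁ := by rw [hF]; exact ⟨hx, hc'.subset⟩
      have hxn := face_sphere hF₁ hxF
      have a1 : sleq (sgn (Dstar D x)) s₁ := by rw [e₁] at hxF; exact hxF.2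
      have a2 : sgn (Dstar D x) = s₁ := by
        refine sleq_antisymm' a1 fun i hi => ?_
        refine (a1 i fun h0 => hi ?_).symm
        exact hc'.superset ((sgn_eq_zero _ _).1 h0)
      have := ri_GG hxn
      rw [a2, ← e₁] at this
      exact this
  · rw [e₁, e₂, d₁, d₂]
    have hsum : ∀ v : Vec n, (∀ i, s₁ i = 0 → Dstar D v i = 0) →
        ∑ i, s₁ i * Dstar D v i = ∑ i, s₂ i * Dstar D v i := by
      intro v hv
      refine Finset.sum_congr rfl fun i _ => ?_
      by_cases h : s₁ i = 0
      · simp [hv i h]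
      · rw [hle i h]
    ext v
    constructor
    · rintro ⟨h1, h2⟩
      refine ⟨⟨fun i hi => h1 i ?_, by rw [← hsum v h1]; exact h2⟩, fun i hi => h1 i hi⟩
      by_contra h
      exact h ((hle i h).symm.trans hi)
    · rintro ⟨⟨h1, h2⟩, h3⟩
      exact ⟨h3, by rw [hsum v h3]; exact h2⟩
end
end

section
/- Let C ⊆ ℝ^n be a nonempty convex set. Then the function L is constant on C if and only if both x ↦ Φx and x ↦ ‖D*x‖₁ are constant on C. -/
open Matrix Set

noncomputable section

/-- `L` is constant on a nonempty convex set `C` iff both `x ↦ Φx` and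
`x ↦ ‖D*x‖₁` are constant on `C`. -/
theorem stmt_15 {n p q : ℕ} (hn : 0 < n) (hp : 0 < p) (hq : 0 < q)
    (D : Matrix (Fin n) (Fin p) ℝ) (Phi : Matrix (Fin q) (Fin n) ℝ)
    (y : Vec q) (lam : ℝ) (hlam : 0 < lam)
    (C : Set (Vec n)) (hCne : C.Nonempty) (hCc : Convex ℝ C) :
    (∀ x ∈ C, ∀ x' ∈ C, Lfun D Phi y lam x = Lfun D Phi y lam x') ↔
      ((∀ x ∈ C, ∀ x' ∈ C, Phi *ᵥ x = Phi *ᵥ x') ∧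
        (∀ x ∈ C, ∀ x' ∈ C, l1 (Dstar D x) = l1 (Dstar D x'))) := by
  constructor
  · intro h
    have key : ∀ x ∈ C, ∀ x' ∈ C, Phi *ᵥ x = Phi *ᵥ x' := by
      intro x hx x' hx'
      have hm : (1/2 : ℝ) • x + (1/2 : ℝ) • x' ∈ C :=
        hCc hx hx' (by norm_num) (by norm_num) (by norm_num)
      have h1 := h x hx x' hx'
      have h2 := h x hx _ hm
      have hl : l1 (Dstar D ((1/2 : ℝ) • x + (1/2 : ℝ) • x')) ≤
          (1/2) * l1 (Dstar D x) + (1/2) * l1 (Dstar D x') := by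
        unfold l1 Dstar
        rw [Finset.mul_sum, Finset.mul_sum, ← Finset.sum_add_distrib]
        apply Finset.sum_le_sum
        intro i _
        rw [Matrix.mulVec_add, Matrix.mulVec_smul, Matrix.mulVec_smul]
        simp only [Pi.add_apply, Pi.smul_apply, smul_eq_mul]
        refine (abs_add_le _ _).trans (le_of_eq ?_)
        rw [abs_mul, abs_mul, abs_of_pos (by norm_num : (0:ℝ) < 1/2)]
      have hq2 : (y - Phi *ᵥ ((1/2 : ℝ) • x + (1/2 : ℝ) • x')) ⬝ᵥ
            (y - Phi *ᵥ ((1/2 : ℝ) • x + (1/2 : ℝ) • x')) =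
          (1/2) * ((y - Phi *ᵥ x) ⬝ᵥ (y - Phi *ᵥ x)) +
          (1/2) * ((y - Phi *ᵥ x') ⬝ᵥ (y - Phi *ᵥ x')) -
          (1/4) * ((Phi *ᵥ x - Phi *ᵥ x') ⬝ᵥ (Phi *ᵥ x - Phi *ᵥ x')) := by
        rw [Matrix.mulVec_add, Matrix.mulVec_smul, Matrix.mulVec_smul]
        simp only [dotProduct]
        rw [Finset.mul_sum, Finset.mul_sum, Finset.mul_sum, ← Finset.sum_add_distrib,
          ← Finset.sum_sub_distrib]
        apply Finset.sum_congr rfl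
        intro i _
        simp only [Pi.add_apply, Pi.sub_apply, Pi.smul_apply, smul_eq_mul]
        ring
      have hl' := mul_le_mul_of_nonneg_left hl hlam.le
      have hle : (Phi *ᵥ x - Phi *ᵥ x') ⬝ᵥ (Phi *ᵥ x - Phi *ᵥ x') ≤ 0 := by
        unfold Lfun at h1 h2
        rw [hq2] at h2
        linarith
      have hge : 0 ≤ (Phi *ᵥ x - Phi *ᵥ x') ⬝ᵥ (Phi *ᵥ x - Phi *ᵥ x') :=
        Finset.sum_nonneg fun i _ => mul_self_nonneg _
      exact sub_eq_zero.mp (dotProduct_self_eq_zero.mp (le_antisymm hle hge))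
    refine ⟨key, fun x hx x' hx' => ?_⟩
    have h1 := h x hx x' hx'
    unfold Lfun at h1
    rw [key x hx x' hx'] at h1
    exact mul_left_cancel₀ hlam.ne' (add_left_cancel h1)
  · rintro ⟨h1, h2⟩ x hx x' hx'
    unfold Lfun
    rw [h1 x hx x' hx', h2 x hx x' hx']
end
end
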